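/- arXiv:2403.16413 — 2 statements merged into one kernel-verified Lean document; each statement's English description precedes it below -/
import Mathlib

section
/- For every h̄ > 0, α ∈ (0,1), and admissible tuning constant ε (i.e. ε ∈ (0,1) if α ≤ e^{−h̄/λ}, and ε ∈ (0, e^{−h̄/λ}) if α > e^{−h̄/λ}), the one-sided NLR test satisfies limsup_{n→∞} ∫ φ_n(y|h̄,ε) dP^n_{θ0}(y) ≤ α. -/
open MeasureTheory Filter Real Topology

noncomputable section

attribute [local instance] Classical.propDecidable

/-- The benchmark nonregular model of Shimizu–Otsu, satisfying Assumption 1.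
`f y θ` denotes the density kernel `f(y|θ)` and the data density is
`y ↦ f(y|θ) · 𝟙{y ≥ g θ}`. -/
structure BenchmarkModel where
  θ0 : ℝ
  /-- density kernel, `f y θ = f(y|θ)` -/
  f : ℝ → ℝ → ℝ
  /-- boundary function -/
  g : ℝ → ℝ
  /-- open neighborhood of `θ0` -/
  N : Set ℝ
  /-- uniform bound on `f` over `N` -/
  C : ℝ
  N_open : IsOpen N
  θ0_mem : θ0 ∈ N
  /-- (a) `y ↦ f(y|θ)·𝟙{y ≥ g θ}` is a probability density for every `θ`. -/
  f_nonneg : ∀ θ y, g θ ≤ y → 0 ≤ f y θ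
  f_integrable : ∀ θ, IntegrableOn (fun y => f y θ) (Set.Ici (g θ))
  f_density : ∀ θ, ∫ y in Set.Ici (g θ), f y θ = 1
  /-- (b) `θ ↦ f(y|θ)` is twice continuously differentiable for every `y`. -/
  f_smooth : ∀ y, ContDiff ℝ 2 fun θ => f y θ
  /-- (c) continuity in `y` for `θ ∈ N`, and uniform positive bounds on `N` -/
  f_cont : ∀ θ ∈ N, Continuous fun y => f y θ
  fθ_cont : ∀ θ ∈ N, Continuous fun y => deriv (fun t => f y t) θ
  f_pos : ∀ θ ∈ N, ∀ y, 0 < f y θ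
  f_lt : ∀ θ ∈ N, ∀ y, f y θ < C
  /-- (d) integrability of the suprema over `N` -/
  int1 : ∫⁻ y : ℝ, ⨆ θ ∈ N,
      ENNReal.ofReal (|deriv (fun t => f y t) θ| * if g θ ≤ y then 1 else 0) < ⊤
  int2 : ∫⁻ y : ℝ, ⨆ θ ∈ N, ⨆ θ' ∈ N, ENNReal.ofReal
      ((deriv (fun t => f y t) θ') ^ 2 / (f y θ') ^ 2 *
        (if g θ ≤ y then 1 else 0) * f y θ) < ⊤
  int3 : ∫⁻ y : ℝ, ⨆ θ ∈ N, ⨆ θ' ∈ N, ENNReal.ofReal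
      (|deriv (deriv fun t => f y t) θ'| / f y θ' *
        (if g θ ≤ y then 1 else 0) * f y θ) < ⊤
  /-- (e) conditions on `g` -/
  g_smooth : ContDiff ℝ 1 g
  g_deriv_pos : 0 < deriv g θ0
  g_deriv_bdd : ∃ B, ∀ θ ∈ N, |deriv g θ| ≤ B

namespace BenchmarkModel

variable (M : BenchmarkModel)

/-- `λ = (f(g(θ0)|θ0)·g'(θ0))⁻¹`. -/
def lam : ℝ := (M.f (M.g M.θ0) M.θ0 * deriv M.g M.θ0)⁻¹

/-- The joint measure `P_θ^n` of an iid sample of size `n` on `ℝ^n`. -/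
def P (n : ℕ) (θ : ℝ) : Measure (Fin n → ℝ) :=
  (volume : Measure (Fin n → ℝ)).withDensity fun y =>
    ENNReal.ofReal (∏ i, M.f (y i) θ * if M.g θ ≤ y i then 1 else 0)

/-- The likelihood-ratio statistic `Z_n(h, h̄)`. -/
def Z (n : ℕ) (h hb : ℝ) : (Fin n → ℝ) → ℝ := fun y =>
  if ∀ i, M.g (M.θ0 + h / n) ≤ y i then
    (if ∀ i, M.g (M.θ0 + hb / n) ≤ y i then 1 else 0) *
      ∏ i, M.f (y i) (M.θ0 + hb / n) / M.f (y i) (M.θ0 + h / n)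
  else 0

end BenchmarkModel

namespace BenchmarkModel

variable (M : BenchmarkModel)

/-- The one-sided NLR test `φ_n(·|h̄,ε)` against the positive alternative,
at significance level `α` (rejection clause taking priority). -/
def phiPlus (n : ℕ) (hb ε α : ℝ) : (Fin n → ℝ) → ℝ :=
  if α ≤ exp (-hb / M.lam) then fun y =>
    if exp (hb / M.lam) * (1 + ε) < M.Z n 0 hb y ∨ ∃ i, y i < M.g M.θ0 then 1
    else if M.Z n 0 hb y ∈ Set.Icc (exp (hb / M.lam) * (1 - ε)) (exp (hb / M.lam) * (1 + ε)) then
      α * exp (hb / M.lam)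
    else 0
  else fun y =>
    if exp (hb / M.lam) * ε < M.Z n 0 hb y ∨ ∃ i, y i < M.g M.θ0 then 1
    else if M.Z n 0 hb y ∈ Set.Icc (-(exp (hb / M.lam) * ε)) (exp (hb / M.lam) * ε) then
      (α - exp (-hb / M.lam)) / (1 - exp (-hb / M.lam))
    else 0

end BenchmarkModel

namespace BenchmarkModel

theorem div_lam (M : BenchmarkModel) (c : ℝ) :
    c / M.lam = c * (M.f (M.g M.θ0) M.θ0 * deriv M.g M.θ0) := by
  rw [lam, div_inv_eq_mul]

theorem exists_sq_sqrt_sub_sqrt_eq (M : BenchmarkModel) {θ : ℝ} (h : M.θ0 < θ)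
    (hN : Set.Icc M.θ0 θ ⊆ M.N) (y : ℝ) :
    ∃ t ∈ Set.Ioo M.θ0 θ, (√(M.f y θ) - √(M.f y M.θ0)) ^ 2 =
      (θ - M.θ0) ^ 2 / 4 * ((deriv (fun s => M.f y s) t) ^ 2 / (M.f y t) ^ 2 * 1 * M.f y t) := by
  have hd : ∀ t ∈ Set.Icc M.θ0 θ, HasDerivAt (fun s => √(M.f y s))
      (deriv (fun s => M.f y s) t / (2 * √(M.f y t))) t := fun t ht =>
    (((M.f_smooth y).differentiable (by norm_num)) t).hasDerivAt.sqrt (M.f_pos t (hN ht) y).ne'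
  obtain ⟨t, ht, hs⟩ := exists_hasDerivAt_eq_slope (fun s => √(M.f y s)) _ h
    (fun t ht => (hd t ht).continuousAt.continuousWithinAt)
    (fun t ht => hd t (Set.Ioo_subset_Icc_self ht))
  refine ⟨t, ht, ?_⟩
  have hp := M.f_pos t (hN (Set.Ioo_subset_Icc_self ht)) y
  have hθ : θ - M.θ0 ≠ 0 := (sub_pos.2 h).ne'
  rw [eq_div_iff hθ] at hs
  have hq := Real.sq_sqrt hp.le
  have hs0 := (Real.sqrt_pos.2 hp).ne'
  rw [← hs, mul_pow, div_pow, mul_pow, hq]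
  field_simp
  norm_num

theorem continuous_sqrt_f (M : BenchmarkModel) {θ : ℝ} (hθ : θ ∈ M.N) :
    Continuous fun y => √(M.f y θ) :=
  Real.continuous_sqrt.comp (M.f_cont θ hθ)

/-- The squared Hellinger distance is of quadratic order in the parameter. -/
theorem exists_hellinger_le (M : BenchmarkModel) : ∃ I : ℝ, 0 ≤ I ∧ ∀ θ, M.θ0 < θ →
    Set.Icc M.θ0 θ ⊆ M.N → MonotoneOn M.g (Set.Icc M.θ0 θ) →
    ∫ y in Set.Ici (M.g θ), (√(M.f y θ) - √(M.f y M.θ0)) ^ 2 ≤ (θ - M.θ0) ^ 2 * I := by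
  set J := ∫⁻ y : ℝ, ⨆ θ ∈ M.N, ⨆ θ' ∈ M.N, ENNReal.ofReal
      ((deriv (fun t => M.f y t) θ') ^ 2 / (M.f y θ') ^ 2 *
        (if M.g θ ≤ y then 1 else 0) * M.f y θ) with hJ
  have hJt : J < ⊤ := M.int2
  refine ⟨J.toReal / 4, by positivity, fun θ h hN hg => ?_⟩
  have hcont : Continuous fun y => (√(M.f y θ) - √(M.f y M.θ0)) ^ 2 :=
    ((M.continuous_sqrt_f (hN (Set.right_mem_Icc.2 h.le))).sub
      (M.continuous_sqrt_f M.θ0_mem)).pow 2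
  rw [integral_eq_lintegral_of_nonneg_ae (ae_of_all _ fun y => sq_nonneg _)
    hcont.aestronglyMeasurable]
  have hle : ∫⁻ y in Set.Ici (M.g θ), ENNReal.ofReal ((√(M.f y θ) - √(M.f y M.θ0)) ^ 2) ≤
      ENNReal.ofReal ((θ - M.θ0) ^ 2 / 4) * J := by
    rw [hJ, ← lintegral_const_mul' _ _ ENNReal.ofReal_ne_top]
    refine (setLIntegral_mono' measurableSet_Ici fun y hy => ?_).trans
      (setLIntegral_le_lintegral _ _)
    obtain ⟨t, ht, he⟩ := M.exists_sq_sqrt_sub_sqrt_eq h hN y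
    have ht' := Set.Ioo_subset_Icc_self ht
    have hgy : M.g t ≤ y := (hg ht' (Set.right_mem_Icc.2 h.le) ht.2.le).trans hy
    rw [he, ENNReal.ofReal_mul (by positivity)]
    gcongr
    refine le_iSup₂_of_le t (hN ht') (le_iSup₂_of_le t (hN ht') ?_)
    rw [if_pos hgy]
  refine (ENNReal.toReal_mono (ENNReal.mul_ne_top ENNReal.ofReal_ne_top hJt.ne) hle).trans
    (le_of_eq ?_)
  rw [ENNReal.toReal_mul, ENNReal.toReal_ofReal (by positivity)]
  ring

theorem integrableOn_f_θ0 (M : BenchmarkModel) {θ : ℝ} (hg : M.g M.θ0 ≤ M.g θ) :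
    IntegrableOn (fun y => M.f y M.θ0) (Set.Ici (M.g θ)) :=
  (M.f_integrable M.θ0).mono_set (Set.Ici_subset_Ici.2 hg)

theorem setIntegral_f_θ0 (M : BenchmarkModel) {θ : ℝ} (hg : M.g M.θ0 ≤ M.g θ) :
    ∫ y in Set.Ici (M.g θ), M.f y M.θ0 = 1 - ∫ y in (M.g M.θ0)..(M.g θ), M.f y M.θ0 := by
  rw [← intervalIntegral.integral_Ioi_sub_Ioi
    ((M.f_integrable M.θ0).mono_set Set.Ioi_subset_Ici_self) hg,
    ← integral_Ici_eq_integral_Ioi, ← integral_Ici_eq_integral_Ioi, M.f_density M.θ0]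
  ring

theorem integrableOn_sqrt_mul_sqrt (M : BenchmarkModel) {θ : ℝ} (hθ : θ ∈ M.N)
    (hg : M.g M.θ0 ≤ M.g θ) :
    IntegrableOn (fun y => √(M.f y θ) * √(M.f y M.θ0)) (Set.Ici (M.g θ)) := by
  refine Integrable.mono' ((M.f_integrable θ).add (M.integrableOn_f_θ0 hg))
    ((M.continuous_sqrt_f hθ).mul (M.continuous_sqrt_f M.θ0_mem)).aestronglyMeasurable
    (ae_of_all _ fun y => ?_)
  have h1 := Real.sq_sqrt (M.f_pos θ hθ y).le
  have h2 := Real.sq_sqrt (M.f_pos M.θ0 M.θ0_mem y).le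
  rw [Real.norm_of_nonneg (by positivity)]
  simp only [Pi.add_apply]
  nlinarith [sq_nonneg (√(M.f y θ) - √(M.f y M.θ0)), sq_nonneg (√(M.f y θ)),
    sq_nonneg (√(M.f y M.θ0))]

/-- The Hellinger affinity on the common support. -/
theorem setIntegral_sqrt_mul_sqrt (M : BenchmarkModel) {θ : ℝ} (hθ : θ ∈ M.N)
    (hg : M.g M.θ0 ≤ M.g θ) :
    ∫ y in Set.Ici (M.g θ), √(M.f y θ) * √(M.f y M.θ0) =
      1 - (∫ y in (M.g M.θ0)..(M.g θ), M.f y M.θ0) / 2 -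
        (∫ y in Set.Ici (M.g θ), (√(M.f y θ) - √(M.f y M.θ0)) ^ 2) / 2 := by
  have he : ∀ y, (√(M.f y θ) - √(M.f y M.θ0)) ^ 2 =
      M.f y θ + M.f y M.θ0 - 2 * (√(M.f y θ) * √(M.f y M.θ0)) := fun y => by
    have h1 := Real.sq_sqrt (M.f_pos θ hθ y).le
    have h2 := Real.sq_sqrt (M.f_pos M.θ0 M.θ0_mem y).le
    linear_combination h1 + h2
  have hadd : IntegrableOn (fun y => M.f y θ + M.f y M.θ0) (Set.Ici (M.g θ)) :=
    (M.f_integrable θ).add (M.integrableOn_f_θ0 hg)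
  simp_rw [he]
  rw [integral_sub hadd
    ((M.integrableOn_sqrt_mul_sqrt hθ hg).const_mul 2),
    integral_add (M.f_integrable θ) (M.integrableOn_f_θ0 hg), integral_const_mul,
    M.f_density θ, M.setIntegral_f_θ0 hg]
  ring

theorem tendsto_nat_mul_boundary_mass (M : BenchmarkModel) (hb : ℝ) (hhb : 0 < hb) :
    Tendsto (fun n : ℕ => (n : ℝ) * ∫ y in (M.g M.θ0)..(M.g (M.θ0 + hb / n)), M.f y M.θ0)
      atTop (𝓝 (hb / M.lam)) := by
  have hc := M.f_cont M.θ0 M.θ0_mem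
  have h1 : HasDerivAt (fun u => ∫ y in (M.g M.θ0)..u, M.f y M.θ0) (M.f (M.g M.θ0) M.θ0)
      (M.g M.θ0) :=
    intervalIntegral.integral_hasDerivAt_right (hc.intervalIntegrable _ _)
      (hc.stronglyMeasurableAtFilter _ _) hc.continuousAt
  have h2 := h1.comp M.θ0 ((M.g_smooth.differentiable (by norm_num)) M.θ0).hasDerivAt
  have h3 := h2.tendsto_slope_zero_right
  have h4 : Tendsto (fun n : ℕ => hb / (n : ℝ)) atTop (𝓝[>] 0) := by
    refine tendsto_nhdsWithin_iff.2 ⟨tendsto_const_div_atTop_nhds_zero_nat hb, ?_⟩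
    filter_upwards [eventually_gt_atTop 0] with n hn
    have : (0 : ℝ) < n := by exact_mod_cast hn
    exact div_pos hhb this
  have h5 := (h3.comp h4).const_mul hb
  rw [M.div_lam]
  refine h5.congr' ?_
  filter_upwards [eventually_gt_atTop 0] with n hn
  have : (0 : ℝ) < n := by exact_mod_cast hn
  simp only [Function.comp, intervalIntegral.integral_same, sub_zero, smul_eq_mul]
  field_simp

theorem eventually_regular (M : BenchmarkModel) (hb : ℝ) (hhb : 0 < hb) :
    ∀ᶠ n : ℕ in atTop, M.θ0 < M.θ0 + hb / n ∧ Set.Icc M.θ0 (M.θ0 + hb / n) ⊆ M.N ∧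
      MonotoneOn M.g (Set.Icc M.θ0 (M.θ0 + hb / n)) := by
  have hgc : Continuous (deriv M.g) := M.g_smooth.continuous_deriv (by norm_num)
  have hnear : ∀ᶠ t in 𝓝 M.θ0, t ∈ M.N ∧ 0 < deriv M.g t :=
    Filter.Eventually.and (M.N_open.mem_nhds M.θ0_mem) (hgc.continuousAt.eventually (lt_mem_nhds M.g_deriv_pos))
  obtain ⟨r, hr, hball⟩ := Metric.eventually_nhds_iff_ball.1 hnear
  filter_upwards [eventually_gt_atTop 0,
    (tendsto_const_div_atTop_nhds_zero_nat hb).eventually (gt_mem_nhds hr)] with n hn hnr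
  have hn0 : (0 : ℝ) < n := by exact_mod_cast hn
  have hsub : ∀ t ∈ Set.Icc M.θ0 (M.θ0 + hb / n), t ∈ M.N ∧ 0 < deriv M.g t := fun t ht => by
    refine hball t ?_
    rw [Metric.mem_ball, Real.dist_eq, abs_lt]
    constructor <;> linarith [ht.1, ht.2]
  refine ⟨by linarith [div_pos hhb hn0], fun t ht => (hsub t ht).1, ?_⟩
  exact monotoneOn_of_deriv_nonneg (convex_Icc _ _) M.g_smooth.continuous.continuousOn
    (M.g_smooth.differentiable (by norm_num)).differentiableOn
    fun t ht => (hsub t (interior_subset ht)).2.le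

theorem tendsto_survival_pow (M : BenchmarkModel) (hb : ℝ) (hhb : 0 < hb) :
    Tendsto (fun n : ℕ => (∫ y in Set.Ici (M.g (M.θ0 + hb / n)), M.f y M.θ0) ^ n) atTop
      (𝓝 (exp (-hb / M.lam))) := by
  have h := (M.tendsto_nat_mul_boundary_mass hb hhb).neg
  rw [← neg_div] at h
  simp_rw [← mul_neg] at h
  refine (Real.tendsto_one_add_pow_exp_of_tendsto h).congr' ?_
  filter_upwards [M.eventually_regular hb hhb] with n ⟨h1, _, h3⟩
  rw [M.setIntegral_f_θ0 (h3 (Set.left_mem_Icc.2 h1.le) (Set.right_mem_Icc.2 h1.le) h1.le),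
    sub_eq_add_neg]

theorem tendsto_affinity_pow (M : BenchmarkModel) (hb : ℝ) (hhb : 0 < hb) :
    Tendsto (fun n : ℕ => (∫ y in Set.Ici (M.g (M.θ0 + hb / n)),
      √(M.f y (M.θ0 + hb / n)) * √(M.f y M.θ0)) ^ n) atTop
      (𝓝 (exp (-(hb / M.lam / 2)))) := by
  obtain ⟨I, hI, hH⟩ := M.exists_hellinger_le
  set H : ℕ → ℝ := fun n => ∫ y in Set.Ici (M.g (M.θ0 + hb / n)),
    (√(M.f y (M.θ0 + hb / n)) - √(M.f y M.θ0)) ^ 2 with hHdef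
  have hnH : Tendsto (fun n : ℕ => (n : ℝ) * H n) atTop (𝓝 0) := by
    refine squeeze_zero' (Eventually.of_forall fun n =>
        mul_nonneg n.cast_nonneg (integral_nonneg fun y => sq_nonneg _)) ?_
      (tendsto_const_div_atTop_nhds_zero_nat (hb ^ 2 * I))
    filter_upwards [M.eventually_regular hb hhb, eventually_gt_atTop 0] with n ⟨h1, h2, h3⟩ hn
    have hn0 : (0 : ℝ) < n := by exact_mod_cast hn
    refine (mul_le_mul_of_nonneg_left (hH _ h1 h2 h3) hn0.le).trans (le_of_eq ?_)
    field_simp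
    ring
  have h := (((M.tendsto_nat_mul_boundary_mass hb hhb).div_const 2).add (hnH.div_const 2)).neg
  have h' : Tendsto (fun n : ℕ => (n : ℝ) *
      (-((∫ y in (M.g M.θ0)..(M.g (M.θ0 + hb / n)), M.f y M.θ0) / 2) - H n / 2)) atTop
      (𝓝 (-(hb / M.lam / 2))) := by
    refine (h.congr fun n => by ring).trans (by simp)
  refine (Real.tendsto_one_add_pow_exp_of_tendsto h').congr' ?_
  filter_upwards [M.eventually_regular hb hhb] with n ⟨h1, h2, h3⟩
  rw [M.setIntegral_sqrt_mul_sqrt (h2 (Set.right_mem_Icc.2 h1.le))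
    (h3 (Set.left_mem_Icc.2 h1.le) (Set.right_mem_Icc.2 h1.le) h1.le)]
  simp only [hHdef]
  ring

theorem prod_indicator_Ici {n : ℕ} (a : ℝ) (F : ℝ → ℝ) (y : Fin n → ℝ) :
    ∏ i, (Set.Ici a).indicator F (y i) = if ∀ i, a ≤ y i then ∏ i, F (y i) else 0 := by
  split_ifs with h
  · exact Finset.prod_congr rfl fun i _ => Set.indicator_of_mem (Set.mem_Ici.2 (h i)) _
  · push Not at h
    obtain ⟨i, hi⟩ := h
    exact Finset.prod_eq_zero (Finset.mem_univ i)
      (Set.indicator_of_notMem (fun hm => hi.not_ge (Set.mem_Ici.1 hm)) _)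

theorem integrable_prod_indicator_Ici (n : ℕ) {a : ℝ} {F : ℝ → ℝ}
    (hF : IntegrableOn F (Set.Ici a)) :
    Integrable fun y : Fin n → ℝ => ∏ i, (Set.Ici a).indicator F (y i) :=
  Integrable.fintype_prod (f := fun _ : Fin n => (Set.Ici a).indicator F)
    fun _ => (integrable_indicator_iff measurableSet_Ici).2 hF

theorem integral_prod_indicator_Ici (n : ℕ) (a : ℝ) (F : ℝ → ℝ) :
    ∫ y : Fin n → ℝ, ∏ i, (Set.Ici a).indicator F (y i) = (∫ y in Set.Ici a, F y) ^ n := by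
  rw [volume_pi, integral_fintype_prod_eq_pow, integral_indicator measurableSet_Ici,
    Fintype.card_fin]

theorem density_eq_prod_indicator (M : BenchmarkModel) {n : ℕ} (y : Fin n → ℝ) :
    ∏ i, M.f (y i) M.θ0 * (if M.g M.θ0 ≤ y i then 1 else 0) =
      ∏ i, (Set.Ici (M.g M.θ0)).indicator (fun y => M.f y M.θ0) (y i) :=
  Finset.prod_congr rfl fun i _ => by simp [Set.indicator_apply]

theorem density_nonneg (M : BenchmarkModel) {n : ℕ} (y : Fin n → ℝ) :
    0 ≤ ∏ i, (Set.Ici (M.g M.θ0)).indicator (fun y => M.f y M.θ0) (y i) :=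
  Finset.prod_nonneg fun _ _ =>
    Set.indicator_nonneg (fun _ _ => (M.f_pos M.θ0 M.θ0_mem _).le) _

theorem integral_P_le (M : BenchmarkModel) {n : ℕ} {φ u : (Fin n → ℝ) → ℝ} (hφ : ∀ y, 0 ≤ φ y)
    (hu : Integrable u)
    (h : ∀ y, (∏ i, (Set.Ici (M.g M.θ0)).indicator (fun y => M.f y M.θ0) (y i)) * φ y ≤ u y) :
    ∫ y, φ y ∂ M.P n M.θ0 ≤ ∫ y, u y := by
  have hf := (M.f_cont M.θ0 M.θ0_mem).measurable
  have hm : Measurable fun y : Fin n → ℝ => ENNReal.ofReal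
      (∏ i, (Set.Ici (M.g M.θ0)).indicator (fun y => M.f y M.θ0) (y i)) :=
    (Finset.measurable_prod _ fun i _ =>
      (hf.indicator measurableSet_Ici).comp (measurable_pi_apply i)).ennreal_ofReal
  simp only [P, M.density_eq_prod_indicator]
  rw [integral_withDensity_eq_integral_toReal_smul hm
    (ae_of_all _ fun y => ENNReal.ofReal_lt_top)]
  simp only [ENNReal.toReal_ofReal (M.density_nonneg _), smul_eq_mul]
  exact integral_mono_of_nonneg
    (ae_of_all _ fun y => mul_nonneg (M.density_nonneg y) (hφ y)) hu (ae_of_all _ h)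

theorem Z_zero_left (M : BenchmarkModel) {n : ℕ} {hb : ℝ}
    (hg : M.g M.θ0 ≤ M.g (M.θ0 + hb / n)) (y : Fin n → ℝ) :
    M.Z n 0 hb y = if ∀ i, M.g (M.θ0 + hb / n) ≤ y i then
      (∏ i, M.f (y i) (M.θ0 + hb / n)) / ∏ i, M.f (y i) M.θ0 else 0 := by
  simp only [Z, zero_div, add_zero, Finset.prod_div_distrib]
  by_cases h : ∀ i, M.g (M.θ0 + hb / n) ≤ y i
  · have h0 : ∀ i, M.g M.θ0 ≤ y i := fun i => hg.trans (h i)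
    simp [h, h0]
  · simp [h]

theorem phiPlus_nonneg (M : BenchmarkModel) (n : ℕ) (hb ε : ℝ) {α : ℝ}
    (hα : α ∈ Set.Ioo (0 : ℝ) 1) (y : Fin n → ℝ) : 0 ≤ M.phiPlus n hb ε α y := by
  have := hα.1
  have := hα.2
  unfold phiPlus
  split_ifs with h
  · dsimp only
    split_ifs <;> positivity
  · dsimp only
    push Not at h
    split_ifs
    · positivity
    · exact div_nonneg (by linarith) (by linarith)
    · exact le_rfl

theorem density_mul_phiPlus_le_of_exp_lt (M : BenchmarkModel) {n : ℕ} {hb ε α : ℝ}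
    (hα : α ∈ Set.Ioo (0 : ℝ) 1) (hlt : exp (-hb / M.lam) < α) (hε : 0 < ε)
    (hg : M.g M.θ0 ≤ M.g (M.θ0 + hb / n)) (y : Fin n → ℝ) :
    (∏ i, (Set.Ici (M.g M.θ0)).indicator (fun y => M.f y M.θ0) (y i)) * M.phiPlus n hb ε α y ≤
      (α - exp (-hb / M.lam)) / (1 - exp (-hb / M.lam)) *
          ∏ i, (Set.Ici (M.g M.θ0)).indicator (fun y => M.f y M.θ0) (y i) +
        (1 - (α - exp (-hb / M.lam)) / (1 - exp (-hb / M.lam))) *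
          ∏ i, (Set.Ici (M.g (M.θ0 + hb / n))).indicator (fun y => M.f y M.θ0) (y i) := by
  set c := (α - exp (-hb / M.lam)) / (1 - exp (-hb / M.lam)) with hc
  have hd : 0 < 1 - exp (-hb / M.lam) := by linarith [hα.2]
  have hc0 : 0 ≤ c := div_nonneg (by linarith) hd.le
  have hc1 : c ≤ 1 := (div_le_one hd).2 (by linarith [hα.2])
  have hK : 0 < exp (hb / M.lam) * ε := by positivity
  simp only [prod_indicator_Ici, phiPlus, if_neg hlt.not_ge, ← hc, M.Z_zero_left hg]
  have hF : 0 < ∏ i, M.f (y i) M.θ0 := Finset.prod_pos fun i _ => M.f_pos _ M.θ0_mem _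
  by_cases h0 : ∀ i, M.g M.θ0 ≤ y i
  · have hex : ¬ ∃ i, y i < M.g M.θ0 := fun ⟨i, hi⟩ => hi.not_ge (h0 i)
    by_cases h : ∀ i, M.g (M.θ0 + hb / n) ≤ y i
    · simp only [h0, h, implies_true, if_true, hex, or_false]
      split_ifs <;> nlinarith
    · simp only [h0, h, implies_true, if_true, if_false, hex, or_false, hK.not_gt, Set.mem_Icc]
      split_ifs <;> nlinarith
  · have h : ¬ ∀ i, M.g (M.θ0 + hb / n) ≤ y i := fun h => h0 fun i => hg.trans (h i)
    simp [h0, h]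

theorem density_mul_phiPlus_le_of_le_exp (M : BenchmarkModel) {n : ℕ} {hb ε α : ℝ}
    (hα : α ∈ Set.Ioo (0 : ℝ) 1) (hle : α ≤ exp (-hb / M.lam)) (hε : ε ∈ Set.Ioo (0 : ℝ) 1)
    (hN : M.θ0 + hb / n ∈ M.N) (hg : M.g M.θ0 ≤ M.g (M.θ0 + hb / n)) (y : Fin n → ℝ) :
    (∏ i, (Set.Ici (M.g M.θ0)).indicator (fun y => M.f y M.θ0) (y i)) * M.phiPlus n hb ε α y ≤
      (exp (hb / M.lam / 2) * (√(1 + ε) - 1))⁻¹ ^ 2 *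
        ((∏ i, (Set.Ici (M.g (M.θ0 + hb / n))).indicator
            (fun y => M.f y (M.θ0 + hb / n)) (y i)) -
          2 * exp (hb / M.lam / 2) * (∏ i, (Set.Ici (M.g (M.θ0 + hb / n))).indicator
            (fun y => √(M.f y (M.θ0 + hb / n)) * √(M.f y M.θ0)) (y i)) +
          exp (hb / M.lam / 2) ^ 2 * (∏ i, (Set.Ici (M.g (M.θ0 + hb / n))).indicator
            (fun y => M.f y M.θ0) (y i))) +
      α * exp (hb / M.lam) * ∏ i, (Set.Ici (M.g (M.θ0 + hb / n))).indicator
            (fun y => M.f y M.θ0) (y i) := by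
  have hs2 : exp (hb / M.lam) = exp (hb / M.lam / 2) ^ 2 := by
    rw [← Real.exp_nat_mul]; congr 1; push_cast; ring
  simp only [prod_indicator_Ici, phiPlus, if_pos hle, M.Z_zero_left hg, hs2]
  have hs : 0 < exp (hb / M.lam / 2) := exp_pos _
  set s := exp (hb / M.lam / 2)
  have hα0 := hα.1
  have hε0 := hε.1
  have hε1 := hε.2
  by_cases h0 : ∀ i, M.g M.θ0 ≤ y i
  swap
  · have h : ¬ ∀ i, M.g (M.θ0 + hb / n) ≤ y i := fun h => h0 fun i => hg.trans (h i)
    simp [h0, h]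
  have hex : ¬ ∃ i, y i < M.g M.θ0 := fun ⟨i, hi⟩ => hi.not_ge (h0 i)
  by_cases h : ∀ i, M.g (M.θ0 + hb / n) ≤ y i
  swap
  · have h1 : ¬ s ^ 2 * (1 + ε) < 0 := by
      have : 0 < s ^ 2 * (1 + ε) := by positivity
      exact this.not_gt
    have h2 : ¬ s ^ 2 * (1 - ε) ≤ 0 := by
      have : 0 < s ^ 2 * (1 - ε) := mul_pos (by positivity) (by linarith)
      exact this.not_ge
    simp only [h, hex, h1, h2, if_false, or_false, Set.mem_Icc, false_and, mul_zero, sub_zero,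
      add_zero]
    exact le_rfl
  simp only [h0, h, implies_true, if_true, hex, or_false, Finset.prod_mul_distrib]
  rw [← Real.sqrt_prod _ fun i _ => (M.f_pos _ hN _).le,
    ← Real.sqrt_prod _ fun i _ => (M.f_pos _ M.θ0_mem _).le]
  have hF0 : 0 < ∏ i, M.f (y i) M.θ0 := Finset.prod_pos fun i _ => M.f_pos _ M.θ0_mem _
  have hF1 : 0 < ∏ i, M.f (y i) (M.θ0 + hb / n) := Finset.prod_pos fun i _ => M.f_pos _ hN _
  set F0 := ∏ i, M.f (y i) M.θ0
  set F1 := ∏ i, M.f (y i) (M.θ0 + hb / n)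
  have hq0 := Real.sq_sqrt hF0.le
  have hq1 := Real.sq_sqrt hF1.le
  have hsq : F1 - 2 * s * (√F1 * √F0) + s ^ 2 * F0 = (√F1 - s * √F0) ^ 2 := by
    linear_combination -hq1 - s ^ 2 * hq0
  rw [hsq]
  have hd : 0 < s * (√(1 + ε) - 1) :=
    mul_pos hs (sub_pos.2 (by rw [Real.lt_sqrt (by norm_num)]; linarith))
  have hT : 0 ≤ (s * (√(1 + ε) - 1))⁻¹ ^ 2 * (√F1 - s * √F0) ^ 2 := by positivity
  have hT2 : 0 ≤ α * s ^ 2 * F0 := by positivity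
  split_ifs with h1 h2
  · rw [lt_div_iff₀ hF0] at h1
    have h3 : s * √(1 + ε) * √F0 ≤ √F1 := by
      refine Real.le_sqrt_of_sq_le ?_
      rw [mul_pow, mul_pow, hq0, Real.sq_sqrt (by linarith)]
      exact h1.le
    have h4 : s * (√(1 + ε) - 1) * √F0 ≤ √F1 - s * √F0 := by linarith
    have h5 : (s * (√(1 + ε) - 1) * √F0) ^ 2 ≤ (√F1 - s * √F0) ^ 2 := by
      gcongr
    have h6 : F0 ≤ (s * (√(1 + ε) - 1))⁻¹ ^ 2 * (√F1 - s * √F0) ^ 2 := by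
      rw [inv_pow, ← div_eq_inv_mul, le_div_iff₀ (by positivity)]
      rw [mul_pow _ (√F0), hq0] at h5
      linarith
    linarith
  · linarith
  · linarith

theorem integral_mul_sub_add_add {X : Type*} [MeasurableSpace X] {μ : Measure X}
    {u v w x : X → ℝ} (K : ℝ) (hu : Integrable u μ) (hv : Integrable v μ) (hw : Integrable w μ)
    (hx : Integrable x μ) :
    ∫ y, (K * (u y - v y + w y) + x y) ∂μ =
      K * (∫ y, u y ∂μ - ∫ y, v y ∂μ + ∫ y, w y ∂μ) + ∫ y, x y ∂μ := by
  have huv : Integrable (fun y => u y - v y) μ := hu.sub hv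
  have huvw : Integrable (fun y => u y - v y + w y) μ := huv.add hw
  rw [integral_add (huvw.const_mul K) hx, integral_const_mul, integral_add huv hw,
    integral_sub hu hv]

theorem limsup_integral_P_le (M : BenchmarkModel) {φ : ∀ n : ℕ, (Fin n → ℝ) → ℝ} {u : ℕ → ℝ}
    {α : ℝ} (hφ : ∀ n y, 0 ≤ φ n y)
    (h : ∀ᶠ n in atTop, ∫ y, φ n y ∂ M.P n M.θ0 ≤ u n) (hu : Tendsto u atTop (𝓝 α)) :
    Filter.limsup (fun n : ℕ => ∫ y, φ n y ∂ M.P n M.θ0) atTop ≤ α :=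
  hu.limsup_eq ▸ limsup_le_limsup h
    (isCoboundedUnder_le_of_le atTop fun n => integral_nonneg (hφ n)) hu.isBoundedUnder_le

/-- Lemma 1(i): the one-sided NLR test is of asymptotic level `α`. -/
theorem nlr_plus_size (M : BenchmarkModel) (hb α ε : ℝ) (hhb : 0 < hb)
    (hα : α ∈ Set.Ioo (0 : ℝ) 1)
    (hε1 : α ≤ exp (-hb / M.lam) → ε ∈ Set.Ioo (0 : ℝ) 1)
    (hε2 : exp (-hb / M.lam) < α → ε ∈ Set.Ioo (0 : ℝ) (exp (-hb / M.lam))) :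
    Filter.limsup (fun n : ℕ => ∫ y, M.phiPlus n hb ε α y ∂ M.P n M.θ0) atTop ≤ α := by
  have hsurv := M.tendsto_survival_pow hb hhb
  have hreg := M.eventually_regular hb hhb
  rcases le_or_gt α (exp (-hb / M.lam)) with hle | hlt
  · have haff := M.tendsto_affinity_pow hb hhb
    set s := exp (hb / M.lam / 2) with hs
    set K := (s * (√(1 + ε) - 1))⁻¹ ^ 2
    have hlim := (((tendsto_const_nhds (x := (1 : ℝ))).sub (haff.const_mul (2 * s))).add
      (hsurv.const_mul (s ^ 2))).const_mul K |>.add (hsurv.const_mul (α * exp (hb / M.lam)))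
    have hval : K * (1 - 2 * s * exp (-(hb / M.lam / 2)) + s ^ 2 * exp (-hb / M.lam)) +
        α * exp (hb / M.lam) * exp (-hb / M.lam) = α := by
      have e1 : s * exp (-(hb / M.lam / 2)) = 1 := by
        rw [hs, ← Real.exp_add, add_neg_cancel, Real.exp_zero]
      have e2 : exp (hb / M.lam) * exp (-hb / M.lam) = 1 := by
        rw [← Real.exp_add, neg_div, add_neg_cancel, Real.exp_zero]
      have e3 : s ^ 2 = exp (hb / M.lam) := by
        rw [hs, ← Real.exp_nat_mul]; congr 1; push_cast; ring
      rw [e3]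
      linear_combination -2 * K * e1 + (K + α) * e2
    rw [hval] at hlim
    refine M.limsup_integral_P_le (fun n => M.phiPlus_nonneg n hb ε hα) ?_ hlim
    filter_upwards [hreg] with n ⟨h1, h2, h3⟩
    have hN := h2 (Set.right_mem_Icc.2 h1.le)
    have hg := h3 (Set.left_mem_Icc.2 h1.le) (Set.right_mem_Icc.2 h1.le) h1.le
    have iA := integrable_prod_indicator_Ici n (M.integrableOn_f_θ0 hg)
    have iB := (integrable_prod_indicator_Ici n
      (M.integrableOn_sqrt_mul_sqrt hN hg)).const_mul (2 * s)
    have iC := integrable_prod_indicator_Ici n (M.f_integrable (M.θ0 + hb / n))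
    refine (M.integral_P_le (M.phiPlus_nonneg n hb ε hα)
      ((((iC.sub iB).add (iA.const_mul (s ^ 2))).const_mul K).add
        (iA.const_mul (α * exp (hb / M.lam))))
      (M.density_mul_phiPlus_le_of_le_exp hα hle (hε1 hle) hN hg)).trans (le_of_eq ?_)
    refine (integral_mul_sub_add_add K iC iB (iA.const_mul (s ^ 2))
      (iA.const_mul (α * exp (hb / M.lam)))).trans ?_
    simp only [integral_const_mul, integral_prod_indicator_Ici, M.f_density, one_pow]
  · set c := (α - exp (-hb / M.lam)) / (1 - exp (-hb / M.lam)) with hc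
    have hlim := (tendsto_const_nhds (x := c * 1)).add (hsurv.const_mul (1 - c))
    have hval : c * 1 + (1 - c) * exp (-hb / M.lam) = α := by
      have hd : 1 - exp (-hb / M.lam) ≠ 0 := by linarith [hα.2]
      have : c * (1 - exp (-hb / M.lam)) = α - exp (-hb / M.lam) := div_mul_cancel₀ _ hd
      linear_combination this
    rw [hval] at hlim
    refine M.limsup_integral_P_le (fun n => M.phiPlus_nonneg n hb ε hα) ?_ hlim
    filter_upwards [hreg] with n ⟨h1, h2, h3⟩
    have hg := h3 (Set.left_mem_Icc.2 h1.le) (Set.right_mem_Icc.2 h1.le) h1.le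
    have i0 := (integrable_prod_indicator_Ici n (M.f_integrable M.θ0)).const_mul c
    have iA := (integrable_prod_indicator_Ici n (M.integrableOn_f_θ0 hg)).const_mul (1 - c)
    refine (M.integral_P_le (M.phiPlus_nonneg n hb ε hα) (i0.add iA)
      (M.density_mul_phiPlus_le_of_exp_lt hα hlt (hε2 hlt).1 hg)).trans (le_of_eq ?_)
    simp only [Pi.add_apply]
    rw [integral_add i0 iA]
    simp only [integral_const_mul, integral_prod_indicator_Ici, M.f_density, one_pow]

end BenchmarkModel
end
end

section
/- For every h̄ > 0, α ∈ (0,1), admissible tuning constant ε (ε ∈ (0,1) if α ≤ e^{−h̄/λ}, ε ∈ (0, e^{−h̄/λ}) if α > e^{−h̄/λ}), and every h > 0, the one-sided NLR test satisfies liminf_{n→∞} ∫ φ_n(y|h̄,ε) dP^n_{θ0+h/n}(y) ≥ π_L(h,h̄), where π_L(h,h̄) := α·e^{min{h,h̄}/λ} if α ≤ e^{−h̄/λ}, and π_L(h,h̄) := (α−e^{−h̄/λ})/(1−e^{−h̄/λ}) + min{e^{(h−h̄)/λ}, 1}·(1−α)/(1−e^{−h̄/λ}) if α > e^{−h̄/λ}.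 -/
open MeasureTheory Filter Real Topology

noncomputable section

attribute [local instance] Classical.propDecidable

namespace BenchmarkModel

variable (M : BenchmarkModel)

/-- The asymptotic local power lower bound `π_L(h, h̄)` at significance level `α`. -/
def piL (h hb α : ℝ) : ℝ :=
  if α ≤ exp (-hb / M.lam) then α * exp (min h hb / M.lam)
  else (α - exp (-hb / M.lam)) / (1 - exp (-hb / M.lam)) +
    min (exp ((h - hb) / M.lam)) 1 * (1 - α) / (1 - exp (-hb / M.lam))

/-- A sequence of measurable functions dominated by a (possibly nonmeasurable) function of finite
lower integral is dominated almost everywhere by an integrable function. -/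
theorem exists_integrable_bound {u : ℕ → ℝ → ℝ} {G : ℝ → ENNReal} {K : ENNReal} (hK : K ≠ ⊤)
    (hu : ∀ᶠ n in atTop, Measurable (u n))
    (hle : ∀ᶠ n in atTop, ∀ y, ENNReal.ofReal |u n y| ≤ K * G y) (hG : ∫⁻ y, G y < ⊤) :
    ∃ b : ℝ → ℝ, Integrable b ∧ ∀ᶠ n in atTop, ∀ᵐ y, |u n y| ≤ b y := by
  obtain ⟨n₀, h₀⟩ := eventually_atTop.1 (hu.and hle)
  have hm : Measurable fun y => ⨆ k, ENNReal.ofReal |u (n₀ + k) y| :=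
    Measurable.iSup fun k => ((h₀ (n₀ + k) (by omega)).1.norm).ennreal_ofReal
  have hfin : ∫⁻ y, ⨆ k, ENNReal.ofReal |u (n₀ + k) y| ≠ ⊤ := by
    refine ne_top_of_le_ne_top (ENNReal.mul_ne_top hK hG.ne) ?_
    rw [← lintegral_const_mul' _ _ hK]
    exact lintegral_mono fun y => iSup_le fun k => (h₀ (n₀ + k) (by omega)).2 y
  refine ⟨_, integrable_toReal_of_lintegral_ne_top hm.aemeasurable hfin, ?_⟩
  filter_upwards [eventually_ge_atTop n₀] with n hn
  filter_upwards [ae_lt_top hm hfin] with y hy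
  obtain ⟨k, rfl⟩ := Nat.exists_eq_add_of_le hn
  rw [← ENNReal.ofReal_le_iff_le_toReal hy.ne]
  exact le_iSup (fun k => ENNReal.ofReal |u (n₀ + k) y|) k

/-- The density `y ↦ f(y|θ)·𝟙{y ≥ g θ}` of a single observation. -/
def density (θ y : ℝ) : ℝ := M.f y θ * if M.g θ ≤ y then 1 else 0

/-- The distribution of a single observation. -/
def single (θ : ℝ) : Measure ℝ := volume.withDensity fun y => ENNReal.ofReal (M.density θ y)

theorem density_eq_indicator (θ : ℝ) :
    M.density θ = (Set.Ici (M.g θ)).indicator fun y => M.f y θ := by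
  ext y
  by_cases h : M.g θ ≤ y <;> simp [density, h]

theorem density_nonneg_s2 (θ y : ℝ) : 0 ≤ M.density θ y := by
  unfold density
  split_ifs with h
  · simpa using M.f_nonneg θ y h
  · simp

theorem integrable_density (θ : ℝ) : Integrable (M.density θ) := by
  rw [density_eq_indicator, integrable_indicator_iff measurableSet_Ici]
  exact M.f_integrable θ

theorem integral_density (θ : ℝ) : ∫ y, M.density θ y = 1 := by
  rw [density_eq_indicator, integral_indicator measurableSet_Ici]
  exact M.f_density θ

instance isProbabilityMeasure_single (θ : ℝ) : IsProbabilityMeasure (M.single θ) := by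
  constructor
  rw [single, withDensity_apply _ MeasurableSet.univ, Measure.restrict_univ,
    ← ofReal_integral_eq_lintegral_ofReal (M.integrable_density θ)
      (ae_of_all _ (M.density_nonneg_s2 θ)), integral_density, ENNReal.ofReal_one]

theorem measurable_density {θ : ℝ} (hθ : θ ∈ M.N) : Measurable (M.density θ) := by
  rw [density_eq_indicator]
  exact (M.f_cont θ hθ).measurable.indicator measurableSet_Ici

theorem P_eq_pi (n : ℕ) (θ : ℝ) : M.P n θ = Measure.pi fun _ => M.single θ := by
  refine (Measure.pi_eq fun s hs => ?_).symm
  rw [P, withDensity_apply _ (MeasurableSet.univ_pi hs), volume_pi, Measure.restrict_pi_pi]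
  have hi : ∀ i, Integrable (M.density θ) (volume.restrict (s i)) := fun i =>
    (M.integrable_density θ).restrict
  have h := integral_fintype_prod_eq_prod (μ := fun i => volume.restrict (s i))
    (fun (_ : Fin n) y => M.density θ y)
  change ∫⁻ y : Fin n → ℝ, ENNReal.ofReal (∏ i, M.density θ (y i)) ∂_ = _
  rw [← ofReal_integral_eq_lintegral_ofReal (Integrable.fintype_prod hi)
    (ae_of_all _ fun y => Finset.prod_nonneg fun i _ => M.density_nonneg_s2 θ (y i)), h,
    ENNReal.ofReal_prod_of_nonneg fun i _ => integral_nonneg (M.density_nonneg_s2 θ)]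
  refine Finset.prod_congr rfl fun i _ => ?_
  rw [single, withDensity_apply _ (hs i), ofReal_integral_eq_lintegral_ofReal (hi i)
      (ae_of_all _ (M.density_nonneg_s2 θ))]

theorem integral_single {θ : ℝ} (hθ : θ ∈ M.N) (u : ℝ → ℝ) :
    ∫ y, u y ∂M.single θ = ∫ y, M.density θ y * u y := by
  rw [single, integral_withDensity_eq_integral_toReal_smul
    (M.measurable_density hθ).ennreal_ofReal (by simp)]
  simp [ENNReal.toReal_ofReal (M.density_nonneg_s2 θ _)]

theorem lam_pos : 0 < M.lam :=
  inv_pos.2 (mul_pos (M.f_pos _ M.θ0_mem _) M.g_deriv_pos)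

/-- To the right of `θ0`, the parameter stays in `N` and the boundary increases. -/
theorem exists_monotoneOn :
    ∃ δ > 0, Set.Icc M.θ0 (M.θ0 + δ) ⊆ M.N ∧ MonotoneOn M.g (Set.Icc M.θ0 (M.θ0 + δ)) := by
  have hc : Continuous (deriv M.g) := M.g_smooth.continuous_deriv le_rfl
  have h : ∀ᶠ t in 𝓝 M.θ0, t ∈ M.N ∧ 0 < deriv M.g t :=
    (M.N_open.eventually_mem M.θ0_mem).and (hc.continuousAt.eventually_const_lt M.g_deriv_pos)
  obtain ⟨δ, hδ, h⟩ := Metric.eventually_nhds_iff.1 h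
  have hb : ∀ t ∈ Set.Icc M.θ0 (M.θ0 + δ / 2), t ∈ M.N ∧ 0 < deriv M.g t := fun t ht =>
    h (by rw [Real.dist_eq, abs_lt]; constructor <;> linarith [ht.1, ht.2])
  refine ⟨δ / 2, by positivity, fun t ht => (hb t ht).1, ?_⟩
  refine monotoneOn_of_deriv_nonneg (convex_Icc _ _) M.g_smooth.continuous.continuousOn
    (M.g_smooth.differentiable one_ne_zero).differentiableOn fun t ht => ?_
  exact (hb t (interior_subset ht)).2.le

theorem tendsto_local (a : ℝ) : Tendsto (fun n : ℕ => M.θ0 + a / n) atTop (𝓝 M.θ0) := by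
  simpa using tendsto_const_nhds.add (tendsto_const_div_atTop_nhds_zero_nat a)

/-- Local parameters eventually lie in an interval where the boundary is monotone. -/
theorem eventually_local (m : ℝ) :
    ∀ᶠ n : ℕ in atTop, 0 < n ∧ Set.Icc M.θ0 (M.θ0 + m / n) ⊆ M.N ∧
      MonotoneOn M.g (Set.Icc M.θ0 (M.θ0 + m / n)) := by
  obtain ⟨δ, hδ, hN, hg⟩ := M.exists_monotoneOn
  filter_upwards [eventually_gt_atTop 0,
    (M.tendsto_local m).eventually_le_const (show M.θ0 < M.θ0 + δ by linarith)] with n hn h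
  have hs := Set.Icc_subset_Icc_right (b := M.θ0) h
  exact ⟨hn, hs.trans hN, hg.mono hs⟩

theorem tendsto_g_local (a : ℝ) :
    Tendsto (fun n : ℕ => M.g (M.θ0 + a / n)) atTop (𝓝 (M.g M.θ0)) :=
  (M.g_smooth.continuous.tendsto _).comp (M.tendsto_local a)

theorem differentiable_f (y : ℝ) : Differentiable ℝ (M.f y) :=
  (M.f_smooth y).differentiable two_ne_zero

/-- Indicators of half-lines with local boundaries converge almost everywhere. -/
theorem eventually_boundary_iff (a : ℝ) :
    ∀ᵐ y : ℝ, ∀ᶠ n : ℕ in atTop, (M.g (M.θ0 + a / n) ≤ y ↔ M.g M.θ0 ≤ y) := by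
  filter_upwards [Measure.ae_ne volume (M.g M.θ0)] with y hy
  rcases lt_or_gt_of_ne hy with h | h
  · filter_upwards [(M.tendsto_g_local a).eventually_const_lt h] with n hn
    simp [hn.not_ge, h.not_ge]
  · filter_upwards [(M.tendsto_g_local a).eventually_lt_const h] with n hn
    simp [hn.le, h.le]

theorem tendsto_mul_sub_of_hasDerivAt {u : ℝ → ℝ} {x u' : ℝ} (hu : HasDerivAt u u' x) {a : ℝ}
    (ha : 0 < a) : Tendsto (fun n : ℕ => n * (u (x + a / n) - u x)) atTop (𝓝 (a * u')) := by
  have h0 : Tendsto (fun n : ℕ => a / n) atTop (𝓝[≠] 0) := by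
    refine tendsto_nhdsWithin_iff.2 ⟨tendsto_const_div_atTop_nhds_zero_nat a, ?_⟩
    filter_upwards [eventually_gt_atTop 0] with n hn
    have : (0 : ℝ) < n := by exact_mod_cast hn
    simp [ha.ne', this.ne']
  have h := ((hasDerivAt_iff_tendsto_slope_zero.1 hu).comp h0).const_mul a
  refine h.congr' ?_
  filter_upwards [eventually_gt_atTop 0] with n hn
  have : (0 : ℝ) < n := by exact_mod_cast hn
  simp only [Function.comp, smul_eq_mul]
  field_simp

theorem exists_deriv_eq_mul_sub {a : ℝ} (ha : 0 < a) {n : ℕ} (hn : 0 < n) {u : ℝ → ℝ}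
    {x : ℝ} (hu : DifferentiableOn ℝ u (Set.Icc x (x + a / n))) :
    ∃ c ∈ Set.Icc x (x + a / n), n * (u (x + a / n) - u x) = a * deriv u c := by
  have hn' : (0 : ℝ) < n := by exact_mod_cast hn
  obtain ⟨c, hc, h⟩ := exists_deriv_eq_slope u (a := x) (b := x + a / n)
    (by linarith [div_pos ha hn']) hu.continuousOn (hu.mono Set.Ioo_subset_Icc_self)
  refine ⟨c, Set.Ioo_subset_Icc_self hc, ?_⟩
  rw [h, add_sub_cancel_left]
  field_simp

/-- The normalized increment of the density kernel, cut at a local boundary. -/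
def increment (a m : ℝ) (n : ℕ) (y : ℝ) : ℝ :=
  if M.g (M.θ0 + m / n) ≤ y then n * (M.f y (M.θ0 + a / n) - M.f y M.θ0) else 0

theorem div_mem_Icc {a m : ℝ} (ha : 0 ≤ a) (ham : a ≤ m) (n : ℕ) :
    M.θ0 + a / n ∈ Set.Icc M.θ0 (M.θ0 + m / n) := by
  have h1 : 0 ≤ a / n := by positivity
  have h2 : a / n ≤ m / n := by gcongr
  constructor <;> linarith

theorem measurable_increment {a m : ℝ} {n : ℕ} (h : M.θ0 + a / n ∈ M.N) :
    Measurable (M.increment a m n) :=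
  Measurable.ite measurableSet_Ici
    (((M.f_cont _ h).sub (M.f_cont _ M.θ0_mem)).const_mul _).measurable measurable_const

theorem exists_increment_bound {a m : ℝ} (ha : 0 < a) (ham : a ≤ m) :
    ∃ b : ℝ → ℝ, Integrable b ∧ ∀ᶠ n in atTop, ∀ᵐ y, |M.increment a m n y| ≤ b y := by
  refine exists_integrable_bound (K := ENNReal.ofReal a) ENNReal.ofReal_ne_top ?_ ?_ M.int1
  · filter_upwards [M.eventually_local m] with n ⟨_, hN, _⟩
    exact M.measurable_increment (hN (M.div_mem_Icc ha.le ham n))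
  · filter_upwards [M.eventually_local m] with n ⟨hn, hN, hg⟩ y
    unfold increment
    split_ifs with hy
    · obtain ⟨c, hc, h⟩ := exists_deriv_eq_mul_sub ha hn
        (M.differentiable_f y).differentiableOn (x := M.θ0)
      have hc' : c ∈ Set.Icc M.θ0 (M.θ0 + m / n) :=
        ⟨hc.1, hc.2.trans (M.div_mem_Icc ha.le ham n).2⟩
      have hm := M.div_mem_Icc (ha.le.trans ham) le_rfl n
      rw [h, abs_mul, abs_of_pos ha, ENNReal.ofReal_mul ha.le]
      gcongr
      refine le_iSup₂_of_le c (hN hc') ?_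
      rw [if_pos ((hg hc' hm hc'.2).trans hy), mul_one]
    · simp

theorem tendsto_integral_increment {a m : ℝ} (ha : 0 < a) (ham : a ≤ m) :
    Tendsto (fun n => ∫ y, M.increment a m n y) atTop
      (𝓝 (a * ∫ y in Set.Ici (M.g M.θ0), deriv (M.f y) M.θ0)) := by
  obtain ⟨b, hb, hle⟩ := M.exists_increment_bound ha ham
  rw [← integral_const_mul, ← integral_indicator measurableSet_Ici]
  refine tendsto_integral_filter_of_dominated_convergence b ?_ hle hb ?_
  · filter_upwards [M.eventually_local m] with n ⟨_, hN, _⟩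
    exact (M.measurable_increment (hN (M.div_mem_Icc ha.le ham n))).aestronglyMeasurable
  · filter_upwards [M.eventually_boundary_iff m] with y hy
    by_cases h : M.g M.θ0 ≤ y
    · rw [Set.indicator_of_mem (by exact h)]
      refine (tendsto_mul_sub_of_hasDerivAt (M.differentiable_f y M.θ0).hasDerivAt ha).congr' ?_
      filter_upwards [hy] with n hn
      rw [increment, if_pos (hn.2 h)]
    · rw [Set.indicator_of_notMem (by exact h)]
      refine tendsto_const_nhds.congr' ?_
      filter_upwards [hy] with n hn
      rw [increment, if_neg fun h' => h (hn.1 h')]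

theorem tendsto_tail {m : ℝ} (hm : 0 < m) :
    Tendsto (fun n : ℕ => n * ((∫ y in Set.Ici (M.g (M.θ0 + m / n)), M.f y M.θ0) - 1)) atTop
      (𝓝 (-(m / M.lam))) := by
  have hc := M.f_cont _ M.θ0_mem
  have hd : HasDerivAt (fun t => ∫ y in M.g M.θ0..M.g t, M.f y M.θ0)
      (M.f (M.g M.θ0) M.θ0 * deriv M.g M.θ0) M.θ0 :=
    (hc.integral_hasStrictDerivAt (M.g M.θ0) (M.g M.θ0)).hasDerivAt.comp M.θ0
      (M.g_smooth.differentiable one_ne_zero M.θ0).hasDerivAt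
  have h := (tendsto_mul_sub_of_hasDerivAt hd hm).neg
  have hl : M.f (M.g M.θ0) M.θ0 * deriv M.g M.θ0 = M.lam⁻¹ := (inv_inv _).symm
  rw [hl, ← div_eq_mul_inv] at h
  refine h.congr' ?_
  filter_upwards [M.eventually_local m] with n ⟨hn, hN, hg⟩
  have hmem := M.div_mem_Icc hm.le le_rfl n
  have hle : M.g M.θ0 ≤ M.g (M.θ0 + m / n) := hg ⟨le_rfl, hmem.1⟩ hmem hmem.1
  have hs := intervalIntegral.integral_Ioi_sub_Ioi
    ((M.f_integrable M.θ0).mono_set Set.Ioi_subset_Ici_self) hle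
  rw [← integral_Ici_eq_integral_Ioi, ← integral_Ici_eq_integral_Ioi, M.f_density] at hs
  simp only [intervalIntegral.integral_same, ← hs]
  ring

theorem integral_increment {a m : ℝ} {n : ℕ} (hg : M.g M.θ0 ≤ M.g (M.θ0 + m / n))
    (hg' : M.g (M.θ0 + a / n) ≤ M.g (M.θ0 + m / n)) :
    ∫ y, M.increment a m n y = n * ((∫ y in Set.Ici (M.g (M.θ0 + m / n)), M.f y (M.θ0 + a / n)) -
      ∫ y in Set.Ici (M.g (M.θ0 + m / n)), M.f y M.θ0) := by
  rw [← integral_sub ((M.f_integrable _).mono_set (Set.Ici_subset_Ici.2 hg'))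
    ((M.f_integrable _).mono_set (Set.Ici_subset_Ici.2 hg)), ← integral_const_mul,
    ← integral_indicator measurableSet_Ici]
  rfl

/-- The score has mean `1/λ`. -/
theorem integral_deriv : ∫ y in Set.Ici (M.g M.θ0), deriv (M.f y) M.θ0 = M.lam⁻¹ := by
  have h1 := M.tendsto_integral_increment one_pos le_rfl
  have h2 := (M.tendsto_tail one_pos).neg
  rw [one_mul] at h1
  rw [neg_neg, one_div] at h2
  refine tendsto_nhds_unique h1 (h2.congr' ?_)
  filter_upwards [M.eventually_local 1] with n ⟨hn, hN, hg⟩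
  have hmem := M.div_mem_Icc zero_le_one le_rfl n
  rw [M.integral_increment (hg ⟨le_rfl, hmem.1⟩ hmem hmem.1) le_rfl, M.f_density]
  ring

/-- Probability that a single observation exceeds a local boundary. -/
theorem single_real_Ici {a m : ℝ} {n : ℕ}
    (hg : M.g (M.θ0 + a / n) ≤ M.g (M.θ0 + m / n)) :
    (M.single (M.θ0 + a / n)).real (Set.Ici (M.g (M.θ0 + m / n))) =
      ∫ y in Set.Ici (M.g (M.θ0 + m / n)), M.f y (M.θ0 + a / n) := by
  rw [measureReal_def, single, withDensity_apply _ measurableSet_Ici,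
    ← ofReal_integral_eq_lintegral_ofReal (M.integrable_density _).restrict
      (ae_of_all _ (M.density_nonneg_s2 _)), ENNReal.toReal_ofReal
      (integral_nonneg (M.density_nonneg_s2 _))]
  refine setIntegral_congr_fun measurableSet_Ici fun y hy => ?_
  simp [density, hg.trans hy]

/-- Limit of the probability that all observations exceed a local boundary. -/
theorem tendsto_P_forall_le {h m : ℝ} (hh : 0 < h) (hm : h ≤ m) :
    Tendsto (fun n : ℕ => (M.P n (M.θ0 + h / n)).real {y | ∀ i, M.g (M.θ0 + m / n) ≤ y i}) atTop
      (𝓝 (exp ((h - m) / M.lam))) := by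
  have hlim := (M.tendsto_integral_increment hh hm).add (M.tendsto_tail (hh.trans_le hm))
  rw [integral_deriv, ← div_eq_mul_inv, ← sub_eq_add_neg, ← sub_div] at hlim
  have hlim' : Tendsto (fun n : ℕ => n *
      ((∫ y in Set.Ici (M.g (M.θ0 + m / n)), M.f y (M.θ0 + h / n)) - 1)) atTop
      (𝓝 ((h - m) / M.lam)) := by
    refine hlim.congr' ?_
    filter_upwards [M.eventually_local m] with n ⟨hn, hN, hg⟩
    have hmem := M.div_mem_Icc (hh.le.trans hm) le_rfl n
    have hmem' := M.div_mem_Icc hh.le hm n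
    rw [M.integral_increment (hg ⟨le_rfl, hmem.1⟩ hmem hmem.1) (hg hmem' hmem hmem'.2)]
    ring
  refine (Real.tendsto_one_add_pow_exp_of_tendsto hlim').congr' ?_
  filter_upwards [M.eventually_local m] with n ⟨hn, hN, hg⟩
  have hmem := M.div_mem_Icc (hh.le.trans hm) le_rfl n
  have hmem' := M.div_mem_Icc hh.le hm n
  have hset : {y : Fin n → ℝ | ∀ i, M.g (M.θ0 + m / n) ≤ y i} =
      Set.univ.pi fun _ => Set.Ici (M.g (M.θ0 + m / n)) := by ext; simp [Pi.le_def]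
  rw [hset, P_eq_pi, measureReal_def, Measure.pi_pi, Finset.prod_const, ENNReal.toReal_pow,
    ← measureReal_def, M.single_real_Ici (hg hmem' hmem hmem'.2)]
  simp

/-- The log-likelihood ratio of a single observation. -/
def logRatio (b : ℝ) (n : ℕ) (y : ℝ) : ℝ := log (M.f y (M.θ0 + b / n)) - log (M.f y M.θ0)

theorem measurable_logRatio {b : ℝ} {n : ℕ} (h : M.θ0 + b / n ∈ M.N) :
    Measurable (M.logRatio b n) :=
  (M.f_cont _ h).measurable.log.sub (M.f_cont _ M.θ0_mem).measurable.log

theorem exists_logRatio_sq_bound {h b : ℝ} (hh : 0 < h) (hb : 0 < b) :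
    ∃ B : ℝ → ℝ, Integrable B ∧ ∀ᶠ n : ℕ in atTop, ∀ᵐ y,
      M.density (M.θ0 + h / n) y * (n * M.logRatio b n y) ^ 2 ≤ B y := by
  refine (exists_integrable_bound (K := ENNReal.ofReal (b ^ 2))
    (u := fun n y => M.density (M.θ0 + h / n) y * (n * M.logRatio b n y) ^ 2)
    ENNReal.ofReal_ne_top ?_ ?_ M.int2).imp fun B hB =>
      ⟨hB.1, hB.2.mono fun n hn => hn.mono fun y hy => (le_abs_self _).trans hy⟩
  · filter_upwards [M.eventually_local h, M.eventually_local b] with n ⟨_, hN, _⟩ ⟨_, hN', _⟩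
    exact (M.measurable_density (hN (M.div_mem_Icc hh.le le_rfl n))).mul
      (((M.measurable_logRatio (hN' (M.div_mem_Icc hb.le le_rfl n))).const_mul _).pow_const 2)
  · filter_upwards [M.eventually_local h, M.eventually_local b] with n ⟨hn, hN, _⟩ ⟨_, hN', _⟩ y
    have hd : ∀ t ∈ Set.Icc M.θ0 (M.θ0 + b / n),
        HasDerivAt (fun t => log (M.f y t)) (deriv (M.f y) t / M.f y t) t := fun t ht =>
      (M.differentiable_f y t).hasDerivAt.log (M.f_pos t (hN' ht) y).ne'
    obtain ⟨c, hc, hs⟩ := exists_deriv_eq_mul_sub hb hn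
      fun t ht => (hd t ht).differentiableAt.differentiableWithinAt
    rw [(hd c hc).deriv] at hs
    change (n : ℝ) * M.logRatio b n y = _ at hs
    rw [hs, abs_of_nonneg (mul_nonneg (M.density_nonneg_s2 _ _) (sq_nonneg _)),
      show M.density (M.θ0 + h / n) y * (b * (deriv (M.f y) c / M.f y c)) ^ 2 =
        b ^ 2 * (deriv (M.f y) c ^ 2 / M.f y c ^ 2 *
          (if M.g (M.θ0 + h / n) ≤ y then 1 else 0) * M.f y (M.θ0 + h / n)) by
        unfold density; ring, ENNReal.ofReal_mul (sq_nonneg b)]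
    gcongr
    exact le_iSup₂_of_le (M.θ0 + h / n) (hN (M.div_mem_Icc hh.le le_rfl n))
      (le_iSup₂_of_le c (hN' hc) le_rfl)

theorem exists_density_bound {h : ℝ} (hh : 0 < h) :
    ∃ B : ℝ → ℝ, Integrable B ∧ ∀ᶠ n : ℕ in atTop, ∀ᵐ y,
      M.density (M.θ0 + h / n) y ≤ B y := by
  obtain ⟨B, hB, hle⟩ := M.exists_increment_bound hh le_rfl
  refine ⟨_, (M.integrable_density M.θ0).add hB, ?_⟩
  filter_upwards [hle, M.eventually_local h] with n hn ⟨h0, hN, hg⟩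
  filter_upwards [hn] with y hy
  have hmem := M.div_mem_Icc hh.le le_rfl n
  have hg' := hg ⟨le_rfl, hmem.1⟩ hmem hmem.1
  have hn1 : (1 : ℝ) ≤ n := by exact_mod_cast h0
  refine le_trans ?_ (add_le_add_right hy _)
  unfold density increment
  split_ifs with h1 h2 h2
  · rw [abs_mul, abs_of_nonneg (by positivity : (0 : ℝ) ≤ n)]
    nlinarith [le_abs_self (M.f y (M.θ0 + h / n) - M.f y M.θ0),
      abs_nonneg (M.f y (M.θ0 + h / n) - M.f y M.θ0)]
  · exact absurd (hg'.trans h1) h2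
  · simpa using M.f_nonneg _ _ h2
  · simp

theorem tendsto_integral_logRatio {h b : ℝ} (hh : 0 < h) (hb : 0 < b) :
    Tendsto (fun n : ℕ => n * ∫ y, M.logRatio b n y ∂M.single (M.θ0 + h / n)) atTop
      (𝓝 (b / M.lam)) := by
  obtain ⟨B₁, hB₁, hle₁⟩ := M.exists_density_bound hh
  obtain ⟨B₂, hB₂, hle₂⟩ := M.exists_logRatio_sq_bound hh hb
  have key : Tendsto (fun n : ℕ => ∫ y, M.density (M.θ0 + h / n) y * (n * M.logRatio b n y)) atTop
      (𝓝 (∫ y, b * (Set.Ici (M.g M.θ0)).indicator (fun y => deriv (M.f y) M.θ0) y)) := by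
    refine tendsto_integral_filter_of_dominated_convergence _ ?_ ?_ (hB₁.add hB₂) ?_
    · filter_upwards [M.eventually_local h, M.eventually_local b] with n ⟨_, hN, _⟩ ⟨_, hN', _⟩
      exact ((M.measurable_density (hN (M.div_mem_Icc hh.le le_rfl n))).mul
        ((M.measurable_logRatio (hN' (M.div_mem_Icc hb.le le_rfl n))).const_mul _)).aestronglyMeasurable
    · filter_upwards [hle₁, hle₂] with n h₁ h₂
      filter_upwards [h₁, h₂] with y h₁ h₂
      refine le_trans ?_ (add_le_add h₁ h₂)
      have hp := M.density_nonneg_s2 (M.θ0 + h / n) y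
      rw [Real.norm_eq_abs, abs_mul, abs_of_nonneg hp]
      nlinarith [mul_nonneg hp (sq_nonneg (|n * M.logRatio b n y| - 1 / 2)),
        sq_abs (n * M.logRatio b n y)]
    · filter_upwards [M.eventually_boundary_iff h] with y hy
      have hf := M.f_pos _ M.θ0_mem y
      have hd := tendsto_mul_sub_of_hasDerivAt
        ((M.differentiable_f y M.θ0).hasDerivAt.log hf.ne') hb
      have hc := ((M.differentiable_f y).continuous.tendsto _).comp (M.tendsto_local h)
      by_cases h0 : M.g M.θ0 ≤ y
      · rw [Set.indicator_of_mem (by exact h0)]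
        have := hc.mul hd
        rw [show M.f y M.θ0 * (b * (deriv (M.f y) M.θ0 / M.f y M.θ0)) =
          b * deriv (M.f y) M.θ0 by field_simp] at this
        refine this.congr' ?_
        filter_upwards [hy] with n hn
        simp [density, hn.2 h0, logRatio]
      · rw [Set.indicator_of_notMem (by exact h0), mul_zero]
        refine tendsto_const_nhds.congr' ?_
        filter_upwards [hy] with n hn
        simp [density, hn, h0]
  rw [integral_const_mul, integral_indicator measurableSet_Ici, integral_deriv,
    ← div_eq_mul_inv] at key
  refine key.congr' ?_
  filter_upwards [M.eventually_local h] with n ⟨_, hN, _⟩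
  rw [M.integral_single (hN (M.div_mem_Icc hh.le le_rfl n)), ← integral_const_mul]
  exact integral_congr_ae (ae_of_all _ fun y => by ring)

theorem exists_logRatio_moment {h b : ℝ} (hh : 0 < h) (hb : 0 < b) :
    ∃ K : ℝ, ∀ᶠ n : ℕ in atTop, MemLp (M.logRatio b n) 2 (M.single (M.θ0 + h / n)) ∧
      n ^ 2 * ∫ y, M.logRatio b n y ^ 2 ∂M.single (M.θ0 + h / n) ≤ K := by
  obtain ⟨B, hB, hle⟩ := M.exists_logRatio_sq_bound hh hb
  refine ⟨∫ y, B y, ?_⟩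
  filter_upwards [hle, M.eventually_local h, M.eventually_local b]
    with n hn ⟨h0, hN, _⟩ ⟨_, hN', _⟩
  have hθ := hN (M.div_mem_Icc hh.le le_rfl n)
  have hL := M.measurable_logRatio (hN' (M.div_mem_Icc hb.le le_rfl n))
  have hn' : (n : ℝ) ≠ 0 := by exact_mod_cast h0.ne'
  have hi : Integrable fun y => M.density (M.θ0 + h / n) y * (n * M.logRatio b n y) ^ 2 := by
    refine hB.mono' ((M.measurable_density hθ).mul
      ((hL.const_mul _).pow_const 2)).aestronglyMeasurable ?_
    filter_upwards [hn] with y hy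
    rwa [Real.norm_eq_abs, abs_of_nonneg (mul_nonneg (M.density_nonneg_s2 _ _) (sq_nonneg _))]
  constructor
  · rw [memLp_two_iff_integrable_sq hL.aestronglyMeasurable, single,
      integrable_withDensity_iff (M.measurable_density hθ).ennreal_ofReal (by simp)]
    refine (hi.const_mul ((n : ℝ) ^ 2)⁻¹).congr (ae_of_all _ fun y => ?_)
    simp only [ENNReal.toReal_ofReal (M.density_nonneg_s2 _ _)]
    field_simp
  · rw [M.integral_single hθ, ← integral_const_mul]
    refine (integral_congr_ae (ae_of_all _ fun y => ?_)).trans_le (integral_mono_ae hi hB hn)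
    ring

/-- The log-likelihood ratio of the sample is asymptotically at least `b/λ`. -/
theorem tendsto_P_sum_logRatio_le {h b c : ℝ} (hh : 0 < h) (hb : 0 < b) (hc : c < b / M.lam) :
    Tendsto (fun n : ℕ => (M.P n (M.θ0 + h / n)).real {y | ∑ i, M.logRatio b n (y i) ≤ c}) atTop
      (𝓝 0) := by
  obtain ⟨K, hK⟩ := M.exists_logRatio_moment hh hb
  set η := (b / M.lam - c) / 2 with hη
  have hη0 : 0 < η := by rw [hη]; linarith
  have hmean := (M.tendsto_integral_logRatio hh hb).eventually_const_lt
    (show c + η < b / M.lam by linarith)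
  have hlim : Tendsto (fun n : ℕ => (K / n) / η ^ 2) atTop (𝓝 0) := by
    simpa using (tendsto_const_div_atTop_nhds_zero_nat K).div_const (η ^ 2)
  refine squeeze_zero' (Eventually.of_forall fun n => measureReal_nonneg) ?_ hlim
  filter_upwards [hK, hmean, eventually_gt_atTop 0] with n ⟨hL, hn⟩ hm h0
  have hn' : (0 : ℝ) < n := by exact_mod_cast h0
  set ν := M.single (M.θ0 + h / n)
  set S : (Fin n → ℝ) → ℝ := ∑ i, fun y => M.logRatio b n (y i) with hS
  have hSy : ∀ y, S y = ∑ i, M.logRatio b n (y i) := fun y => by simp [hS]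
  have hLi : ∀ i : Fin n, MemLp (fun y : Fin n → ℝ => M.logRatio b n (y i)) 2
      (Measure.pi fun _ => ν) := fun i =>
    hL.comp_measurePreserving (measurePreserving_eval (fun _ : Fin n => ν) i)
  have hSL : MemLp S 2 (Measure.pi fun _ => ν) := memLp_finsetSum' _ fun i _ => hLi i
  have hES : ∫ y, S y ∂(Measure.pi fun _ => ν) = n * ∫ y, M.logRatio b n y ∂ν := by
    simp only [hSy]
    rw [integral_finsetSum _ fun i _ => (hLi i).integrable one_le_two]
    simp [integral_comp_eval (μ := fun _ : Fin n => ν) hL.aestronglyMeasurable]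
  have hVar : ProbabilityTheory.variance S (Measure.pi fun _ => ν) ≤ K / n := by
    rw [hS, ProbabilityTheory.variance_sum_pi (μ := fun _ : Fin n => ν) fun _ => hL,
      Finset.sum_const, Finset.card_univ, Fintype.card_fin, nsmul_eq_mul, le_div_iff₀ hn']
    refine le_trans ?_ hn
    have := ProbabilityTheory.variance_le_expectation_sq (μ := ν) hL.aestronglyMeasurable
    simp only [Pi.pow_apply] at this
    nlinarith [mul_le_mul_of_nonneg_left this (sq_nonneg (n : ℝ))]
  have hcheb := ProbabilityTheory.meas_ge_le_variance_div_sq hSL hη0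
  rw [P_eq_pi]
  have hsub : {y : Fin n → ℝ | ∑ i, M.logRatio b n (y i) ≤ c} ⊆
      {y | η ≤ |S y - ∫ x, S x ∂(Measure.pi fun _ => ν)|} := fun y hy => by
    rw [Set.mem_ofPred_eq, ← hSy] at hy
    rw [Set.mem_ofPred_eq, hES, abs_sub_comm]
    exact le_trans (by linarith) (le_abs_self _)
  refine (measureReal_mono hsub).trans ?_
  refine (ENNReal.toReal_mono ENNReal.ofReal_ne_top hcheb).trans ?_
  rw [ENNReal.toReal_ofReal (div_nonneg (ProbabilityTheory.variance_nonneg _ _) (sq_nonneg _))]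
  gcongr

theorem measurable_Z {b : ℝ} {n : ℕ} (h : M.θ0 + b / n ∈ M.N) : Measurable (M.Z n 0 b) := by
  have hset : ∀ x : ℝ, MeasurableSet {y : Fin n → ℝ | ∀ i, x ≤ y i} := fun x => measurableSet_Ici
  have h0 : M.θ0 + 0 / n ∈ M.N := by simpa using M.θ0_mem
  refine Measurable.ite (hset _) (Measurable.mul (Measurable.ite (hset _) measurable_const
    measurable_const) (Finset.measurable_prod _ fun i _ => ?_)) measurable_const
  exact ((M.f_cont _ h).measurable.comp (measurable_pi_apply i)).div
    ((M.f_cont _ h0).measurable.comp (measurable_pi_apply i))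

theorem Z_nonneg {b : ℝ} {n : ℕ} (h : M.θ0 + b / n ∈ M.N) (y : Fin n → ℝ) : 0 ≤ M.Z n 0 b y := by
  have h0 : M.θ0 + 0 / n ∈ M.N := by simpa using M.θ0_mem
  have hp : 0 ≤ ∏ i, M.f (y i) (M.θ0 + b / n) / M.f (y i) (M.θ0 + 0 / n) :=
    Finset.prod_nonneg fun i _ => (div_pos (M.f_pos _ h _) (M.f_pos _ h0 _)).le
  unfold Z
  split_ifs
  · rwa [one_mul]
  · rw [zero_mul]
  · exact le_rfl

theorem Z_eq_exp {b : ℝ} {n : ℕ} (h : M.θ0 + b / n ∈ M.N) {y : Fin n → ℝ}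
    (h0 : ∀ i, M.g M.θ0 ≤ y i) (hy : ∀ i, M.g (M.θ0 + b / n) ≤ y i) :
    M.Z n 0 b y = exp (∑ i, M.logRatio b n (y i)) := by
  simp only [Z, zero_div, add_zero]
  rw [if_pos h0, if_pos hy, one_mul, exp_sum]
  refine Finset.prod_congr rfl fun i _ => ?_
  rw [logRatio, exp_sub, exp_log (M.f_pos _ h _), exp_log (M.f_pos _ M.θ0_mem _)]

theorem measurable_phiPlus {b ε α : ℝ} {n : ℕ} (h : M.θ0 + b / n ∈ M.N) :
    Measurable (M.phiPlus n b ε α) := by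
  have hZ := M.measurable_Z h
  have hex : MeasurableSet {y : Fin n → ℝ | ∃ i, y i < M.g M.θ0} := by
    simp only [Set.ofPred_exists]
    exact MeasurableSet.iUnion fun i => measurableSet_lt (measurable_pi_apply i) measurable_const
  have hrej : ∀ x, MeasurableSet {y | x < M.Z n 0 b y ∨ ∃ i, y i < M.g M.θ0} := fun x =>
    (measurableSet_lt measurable_const hZ).union hex
  have hmid : ∀ s t u : ℝ, Measurable fun y => if M.Z n 0 b y ∈ Set.Icc s t then u else 0 :=
    fun s t u => Measurable.ite (hZ measurableSet_Icc) measurable_const measurable_const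
  unfold phiPlus
  split_ifs
  · exact Measurable.ite (hrej _) measurable_const (hmid _ _ _)
  · exact Measurable.ite (hrej _) measurable_const (hmid _ _ _)

/-- A test which equals at least `p` everywhere and at least `q` on the event that all observations
exceed the relevant boundaries and the likelihood ratio exceeds `δ·e^{h̄/λ}`, `δ < 1`, has
asymptotic local power at least `p + (q - p)·e^{(h - max h h̄)/λ}`. -/
theorem le_liminf_integral {b h p q δ : ℝ} (hh : 0 < h) (hb : 0 < b) (hpq : p ≤ q)
    (hδ : δ ∈ Set.Ioo (0 : ℝ) 1) {φ : (n : ℕ) → (Fin n → ℝ) → ℝ}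
    (hφ : ∀ n : ℕ, M.θ0 + b / n ∈ M.N → Measurable (φ n) ∧ (∀ y, p ≤ φ n y ∧ |φ n y| ≤ 1) ∧
      ∀ y, (∀ i, M.g M.θ0 ≤ y i) → exp (b / M.lam) * δ < M.Z n 0 b y → q ≤ φ n y) :
    p + (q - p) * exp ((h - max h b) / M.lam) ≤
      liminf (fun n : ℕ => ∫ y, φ n y ∂M.P n (M.θ0 + h / n)) atTop := by
  have hm : 0 < max h b := hh.trans_le (le_max_left _ _)
  set c := b / M.lam + log δ with hc
  have hlogδ : log δ < 0 := log_neg hδ.1 hδ.2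
  have hlim := (((M.tendsto_P_forall_le hh (le_max_left h b)).sub
    (M.tendsto_P_sum_logRatio_le hh hb (c := c) (by linarith))).const_mul (q - p)).const_add p
  rw [sub_zero] at hlim
  rw [← hlim.liminf_eq]
  have hprob : ∀ n θ, IsProbabilityMeasure (M.P n θ) := fun n θ => by
    rw [P_eq_pi]; infer_instance
  have hbdd : ∀ᶠ n : ℕ in atTop, ∫ y, φ n y ∂M.P n (M.θ0 + h / n) ≤ 1 := by
    filter_upwards [M.eventually_local (max h b)] with n ⟨_, hN, _⟩
    have hn := (hφ n (hN (M.div_mem_Icc hb.le (le_max_right _ _) n))).2.1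
    have := hprob n (M.θ0 + h / n)
    simpa using (Real.le_norm_self _).trans (norm_integral_le_of_norm_le_const
      (μ := M.P n (M.θ0 + h / n)) (f := φ n) (ae_of_all _ fun y => (hn y).2))
  refine liminf_le_liminf ?_ hlim.isBoundedUnder_ge
    (isCoboundedUnder_ge_of_eventually_le atTop hbdd)
  filter_upwards [M.eventually_local (max h b)] with n ⟨_, hN, hg⟩
  have := hprob n (M.θ0 + h / n)
  set μ := M.P n (M.θ0 + h / n)
  have hbm := M.div_mem_Icc hb.le (le_max_right h b) n
  have hmm := M.div_mem_Icc hm.le le_rfl n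
  obtain ⟨hmeas, hbd, hq⟩ := hφ n (hN hbm)
  set E := {y : Fin n → ℝ | ∀ i, M.g (M.θ0 + max h b / n) ≤ y i}
  set B := {y : Fin n → ℝ | ∑ i, M.logRatio b n (y i) ≤ c}
  have hE : MeasurableSet E := measurableSet_Ici
  have hB : MeasurableSet B := measurableSet_le (Finset.measurable_sum _ fun i _ =>
    (M.measurable_logRatio (hN hbm)).comp (measurable_pi_apply i)) measurable_const
  have hφi : Integrable (φ n) μ :=
    (integrable_const (1 : ℝ)).mono' hmeas.aestronglyMeasurable (ae_of_all _ fun y => (hbd y).2)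
  have hlow : ∀ y, p + (E \ B).indicator (fun _ => q - p) y ≤ φ n y := fun y => by
    by_cases hy : y ∈ E \ B
    · rw [Set.indicator_of_mem hy, add_sub_cancel]
      have h0 : ∀ i, M.g M.θ0 ≤ y i := fun i =>
        (hg ⟨le_rfl, hmm.1⟩ hmm hmm.1).trans (hy.1 i)
      refine hq y h0 ?_
      rw [M.Z_eq_exp (hN hbm) h0 fun i => (hg hbm hmm hbm.2).trans (hy.1 i)]
      calc exp (b / M.lam) * δ = exp c := by rw [hc, exp_add, exp_log hδ.1]
        _ < _ := exp_lt_exp.2 (not_le.1 hy.2)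
    · rw [Set.indicator_of_notMem hy, add_zero]
      exact (hbd y).1
  calc p + (q - p) * (μ.real E - μ.real B)
      ≤ p + (q - p) * μ.real (E \ B) := by
        gcongr
        exact le_measureReal_sdiff
    _ = ∫ y, p + (E \ B).indicator (fun _ => q - p) y ∂μ := by
        rw [integral_add (integrable_const _)
          ((integrable_const _).indicator (hE.diff hB)), integral_indicator_const _ (hE.diff hB)]
        simp [mul_comm]
    _ ≤ ∫ y, φ n y ∂μ := integral_mono ((integrable_const _).add
        ((integrable_const _).indicator (hE.diff hB))) hφi hlow

/-- Lemma 1(ii): lower bound on the asymptotic local power of the one-sided NLR test. -/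
theorem nlr_plus_power (M : BenchmarkModel) (hb α ε h : ℝ) (hhb : 0 < hb)
    (hα : α ∈ Set.Ioo (0 : ℝ) 1)
    (hε1 : α ≤ exp (-hb / M.lam) → ε ∈ Set.Ioo (0 : ℝ) 1)
    (hε2 : exp (-hb / M.lam) < α → ε ∈ Set.Ioo (0 : ℝ) (exp (-hb / M.lam)))
    (hh : 0 < h) :
    M.piL h hb α ≤
      Filter.liminf (fun n : ℕ => ∫ y, M.phiPlus n hb ε α y ∂ M.P n (M.θ0 + h / n)) atTop := by
  have hl := M.lam_pos
  have hinv : exp (-hb / M.lam) * exp (hb / M.lam) = 1 := by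
    rw [← exp_add, neg_div, neg_add_cancel, exp_zero]
  have hpos := exp_pos (hb / M.lam)
  have hlt : exp (-hb / M.lam) < 1 := exp_lt_one_iff.2 (div_neg_of_neg_of_pos (by linarith) hl)
  rcases le_or_gt α (exp (-hb / M.lam)) with hc | hc
  · obtain ⟨hε0, hε1⟩ := hε1 hc
    have hq1 : α * exp (hb / M.lam) ≤ 1 := hinv ▸ mul_le_mul_of_nonneg_right hc hpos.le
    have hq0 : 0 ≤ α * exp (hb / M.lam) := mul_nonneg hα.1.le hpos.le
    refine le_trans (le_of_eq ?_) (M.le_liminf_integral hh hhb hq0 (δ := 1 - ε)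
      ⟨by linarith, by linarith⟩ fun n hn => ⟨M.measurable_phiPlus hn, fun y => ?_, fun y h0 hZ => ?_⟩)
    · rw [piL, if_pos hc, zero_add, sub_zero, mul_assoc, ← exp_add, ← add_div,
        show min h hb = hb + (h - max h hb) by linarith [min_add_max h hb]]
    · rw [phiPlus, if_pos hc]
      split_ifs <;> simp [hq0, hq1, abs_of_nonneg hq0]
    · rw [phiPlus, if_pos hc]
      split_ifs with h1 h2
      · exact hq1
      · exact le_rfl
      · exact absurd ⟨hZ.le, not_lt.1 fun h' => h1 (Or.inl h')⟩ h2
  · obtain ⟨hε0, hε1⟩ := hε2 hc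
    have hd : 0 < 1 - exp (-hb / M.lam) := by linarith
    have hp0 : 0 ≤ (α - exp (-hb / M.lam)) / (1 - exp (-hb / M.lam)) :=
      div_nonneg (by linarith) hd.le
    have hp1 : (α - exp (-hb / M.lam)) / (1 - exp (-hb / M.lam)) ≤ 1 :=
      (div_le_one hd).2 (by linarith [hα.2])
    refine le_trans (le_of_eq ?_) (M.le_liminf_integral hh hhb hp1 (δ := ε)
      ⟨hε0, hε1.trans hlt⟩ fun n hn => ⟨M.measurable_phiPlus hn, fun y => ?_, fun y h0 hZ => ?_⟩)
    · have hmin : min (exp ((h - hb) / M.lam)) 1 = exp ((h - max h hb) / M.lam) := by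
        rcases le_total h hb with hle | hle
        · rw [max_eq_right hle, min_eq_left]
          exact exp_le_one_iff.2 (div_nonpos_of_nonpos_of_nonneg (by linarith) hl.le)
        · rw [max_eq_left hle, sub_self, zero_div, exp_zero, min_eq_right]
          exact one_le_exp (div_nonneg (by linarith) hl.le)
      rw [piL, if_neg hc.not_ge, hmin]
      have := hd.ne'
      generalize exp (-hb / M.lam) = r at *
      field_simp
      ring
    · rw [phiPlus, if_neg hc.not_ge]
      split_ifs with h1 h2
      · simp [hp1]
      · rw [abs_of_nonneg hp0]
        exact ⟨le_rfl, hp1⟩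
      · exact absurd ⟨(neg_nonpos.2 (mul_nonneg hpos.le hε0.le)).trans (M.Z_nonneg hn y),
          not_lt.1 fun h' => h1 (Or.inl h')⟩ h2
    · rw [phiPlus, if_neg hc.not_ge]
      rw [if_pos (Or.inl hZ)]

end BenchmarkModel
end
end
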